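/- Let (R,m) be a Noetherian local commutative ring of prime characteristic p with depth R = 0, and let c(R) be the smallest positive integer s such that the socle (0:m)_R is not contained in m^s. If M is a finitely generated R-module such that Tor^R_j(M, ^{φ^r}R) = 0 for some integer j ≥ 1 and some integer r with p^r > c(R), then M is projective. -/

import Mathlib

open CategoryTheory

universe u

/-- `R` viewed as a module over itself by restriction of scalars along a ring
endomorphism `f : R →+* R` (here `f` will be the `r`-th Frobenius power `a ↦ a ^ p ^ r`),
i.e. the module `^{φ^r}R` with action `a · b = f a * b = a ^ p ^ r * b`. -/
noncomputable abbrev frobMod {R : Type u} [CommRing R] (f : R →+* R) : ModuleCat.{u} R :=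
  (ModuleCat.restrictScalars f).obj (ModuleCat.of R R)

/-- The depth of a commutative ring `R` with respect to an ideal `I` (take `I = m`):
the supremum of lengths of `R`-regular sequences contained in `I`. -/
noncomputable def depthWrt (R : Type u) [CommRing R] (I : Ideal R) : ℕ∞ :=
  sSup {n : ℕ∞ | ∃ rs : List R, (∀ y ∈ rs, y ∈ I) ∧
    RingTheory.Sequence.IsRegular R rs ∧ (rs.length : ℕ∞) = n}

open TensorProduct IsLocalRing in
/-- A finitely generated module over a local ring has a minimal free cover. -/
theorem exists_minimal_free_cover (R : Type*) [CommRing R] [IsLocalRing R]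
    (M : Type*) [AddCommGroup M] [Module R M] [Module.Finite R M] :
    ∃ (n : ℕ) (g : (Fin n → R) →ₗ[R] M), Function.Surjective g ∧
      ∀ x ∈ LinearMap.ker g, ∀ i, x i ∈ maximalIdeal R := by
  let e := Module.finBasis (ResidueField R) (ResidueField R ⊗[R] M)
  have hsurj : Function.Surjective (TensorProduct.mk R (ResidueField R) M 1) :=
    TensorProduct.mk_surjective R M _ Ideal.Quotient.mk_surjective
  choose v hv using fun i => hsurj (e i)
  refine ⟨_, Fintype.linearCombination R v, ?_, fun x hx i => ?_⟩
  · rw [← LinearMap.range_eq_top, Fintype.range_linearCombination]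
    exact span_eq_top_of_tmul_eq_basis v e hv
  · have h0 : ∑ i, residue R (x i) • e i = 0 := by
      have := congrArg (TensorProduct.mk R (ResidueField R) M 1) (LinearMap.mem_ker.mp hx)
      rw [Fintype.linearCombination_apply, map_sum, map_zero] at this
      simp only [map_smul, hv] at this
      rw [← this]
      refine Finset.sum_congr rfl fun i _ => ?_
      exact algebraMap_smul (ResidueField R) (x i) (e i)
    exact (residue_eq_zero_iff _).mp (Fintype.linearIndependent_iff.mp e.linearIndependent _ h0 i)

open TensorProduct IsLocalRing in
/-- A nonzero finitely generated module over a local ring surjects onto the residue field. -/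
theorem exists_linearMap_residueField_eq_one (R : Type*) [CommRing R] [IsLocalRing R]
    (K : Type*) [AddCommGroup K] [Module R K] [Module.Finite R K] [Nontrivial K] :
    ∃ (l : K →ₗ[R] R ⧸ maximalIdeal R) (k : K), l k = 1 := by
  obtain ⟨n, g, hg, hmin⟩ := exists_minimal_free_cover R K
  have hn : Nonempty (Fin n) := by
    by_contra h
    rw [not_nonempty_iff] at h
    exact not_subsingleton K hg.subsingleton
  obtain ⟨i⟩ := hn
  have hker : LinearMap.ker g ≤
      LinearMap.ker ((maximalIdeal R).mkQ ∘ₗ LinearMap.proj (R := R) (φ := fun _ => R) i) := by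
    intro x hx
    simpa [Ideal.Quotient.eq_zero_iff_mem] using hmin x hx i
  let l := (LinearMap.ker g).liftQ _ hker ∘ₗ
    (g.quotKerEquivOfSurjective hg).symm.toLinearMap
  refine ⟨l, g (Pi.single i 1), ?_⟩
  have : (g.quotKerEquivOfSurjective hg).symm (g (Pi.single i 1)) =
      (LinearMap.ker g).mkQ (Pi.single i 1) := by
    rw [LinearEquiv.symm_apply_eq]; rfl
  simp only [l, LinearMap.comp_apply, LinearEquiv.coe_coe, this]
  simp

open TensorProduct in
/-- Dimension shifting by one step in the first tensor factor. -/
theorem mem_range_lTensor_of_exact {R : Type*} [CommRing R]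
    {K F M P₃ P₂ P₁ P₀ : Type*} [AddCommGroup K] [AddCommGroup F] [AddCommGroup M]
    [AddCommGroup P₃] [AddCommGroup P₂] [AddCommGroup P₁] [AddCommGroup P₀]
    [Module R K] [Module R F] [Module R M] [Module R P₃] [Module R P₂] [Module R P₁]
    [Module R P₀] [Module.Flat R F] [Module.Flat R P₁] [Module.Flat R P₂]
    {ι : K →ₗ[R] F} {π : F →ₗ[R] M} (hι : Function.Injective ι) (hπ : Function.Surjective π)
    (hιπ : Function.Exact ι π)
    {d₃ : P₃ →ₗ[R] P₂} {d₂ : P₂ →ₗ[R] P₁} {d₁ : P₁ →ₗ[R] P₀}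
    (hd₃₂ : Function.Exact d₃ d₂) (hd : Function.Exact d₂ d₁)
    (hM : Function.Exact (d₃.lTensor M) (d₂.lTensor M))
    (z : K ⊗[R] P₁) (hz : TensorProduct.map ι d₁ z = 0) :
    z ∈ LinearMap.range (d₂.lTensor K) := by
  have hι₁ : Function.Injective (ι.rTensor P₁) := Module.Flat.rTensor_preserves_injective_linearMap ι hι
  have h1 : d₁.lTensor F (ι.rTensor P₁ z) = 0 := by
    rw [← LinearMap.comp_apply, LinearMap.lTensor_comp_rTensor, hz]
  obtain ⟨w, hw⟩ := (Module.Flat.lTensor_exact F hd _).mp h1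
  have h2 : d₂.lTensor M (π.rTensor P₂ w) = 0 := by
    rw [← LinearMap.comp_apply, LinearMap.lTensor_comp_rTensor,
      ← LinearMap.rTensor_comp_lTensor, LinearMap.comp_apply, hw]
    exact (rTensor_exact P₁ hιπ hπ).apply_apply_eq_zero z
  obtain ⟨v, hv⟩ := (hM _).mp h2
  obtain ⟨v', rfl⟩ := LinearMap.rTensor_surjective P₃ hπ v
  have h3 : π.rTensor P₂ (w - d₃.lTensor F v') = 0 := by
    rw [map_sub, ← hv, sub_eq_zero, ← LinearMap.comp_apply, ← LinearMap.comp_apply,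
      LinearMap.lTensor_comp_rTensor, LinearMap.rTensor_comp_lTensor]
  obtain ⟨u, hu⟩ := (rTensor_exact P₂ hιπ hπ _).mp h3
  refine ⟨u, hι₁ ?_⟩
  rw [← LinearMap.comp_apply, LinearMap.rTensor_comp_lTensor, ← LinearMap.lTensor_comp_rTensor,
    LinearMap.comp_apply, hu, map_sub, hw,
    (Module.Flat.lTensor_exact F hd₃₂).apply_apply_eq_zero, sub_zero]

open TensorProduct IsLocalRing in
/-- If `e.symm s` annihilates every pure tensor over `K` in the twist `N` of `R` by `a ↦ a ^ q`,
while `s` is not in `m ^ c` for some `c ≤ q`, then the finitely generated module `K` vanishes. -/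
theorem eq_bot_of_forall_tmul_eq_zero {R : Type*} [CommRing R] [IsLocalRing R] {q c : ℕ}
    (hcq : c ≤ q) {s : R} (hs : s ∉ maximalIdeal R ^ c)
    {F N : Type*} [AddCommGroup F] [Module R F] [AddCommGroup N] [Module R N]
    (e : N ≃+ R) (he : ∀ (a : R) (b : N), e (a • b) = a ^ q * e b)
    (K : Submodule R F) [Module.Finite R K]
    (hK : ∀ k : K, k ⊗ₜ[R] e.symm s = 0) : K = ⊥ := by
  by_contra hne
  have : Nontrivial K := Submodule.nontrivial_iff_ne_bot.mpr hne
  obtain ⟨l, k, hlk⟩ := exists_linearMap_residueField_eq_one R K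
  have h := congrArg (quotTensorEquivQuotSMul N (maximalIdeal R)) (congrArg (l.rTensor N) (hK k))
  rw [LinearMap.rTensor_tmul, hlk, map_zero, map_zero, ← map_one (Ideal.Quotient.mk _),
    quotTensorEquivQuotSMul_mk_tmul, one_smul, Submodule.Quotient.mk_eq_zero] at h
  have key : ∀ b ∈ maximalIdeal R • (⊤ : Submodule R N), e b ∈ maximalIdeal R ^ c := by
    intro b hb
    refine Submodule.smul_induction_on hb (fun a ha n _ => ?_) (fun x y hx hy => ?_)
    · rw [he]
      exact Ideal.mul_mem_right _ _ (Ideal.pow_le_pow_right hcq (Ideal.pow_mem_pow ha q))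
    · rw [map_add]; exact add_mem hx hy
  exact hs (by simpa using key _ h)

theorem function_exact_of_shortComplex_exact {R : Type*} [Ring R] {S : ShortComplex (ModuleCat R)}
    (h : S.Exact) : Function.Exact S.f.hom S.g.hom :=
  LinearMap.exact_iff.mpr h.moduleCat_range_eq_ker.symm

open TensorProduct IsLocalRing in
/-- Over a Noetherian local ring whose socle is not contained in `m ^ c`, a finitely generated
module with vanishing higher `Tor` against the twist of `R` by `a ↦ a ^ q`, `c ≤ q`, is free. -/
theorem free_of_exact_lTensor_projectiveResolution {R : Type u} [CommRing R] [IsNoetherianRing R]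
    [IsLocalRing R] {q c : ℕ} (hq : q ≠ 0) (hcq : c ≤ q)
    {s : R} (hsoc : s ∈ (maximalIdeal R).annihilator) (hs : s ∉ maximalIdeal R ^ c)
    {N : ModuleCat.{u} R} (e : N ≃+ R) (he : ∀ (a : R) (b : N), e (a • b) = a ^ q * e b)
    (P : ProjectiveResolution N) (j : ℕ)
    (M : Type u) [AddCommGroup M] [Module R M] [Module.Finite R M]
    (hM : Function.Exact ((P.complex.d (j + 2) (j + 1)).hom.lTensor M)
      ((P.complex.d (j + 1) j).hom.lTensor M)) : Module.Free R M := by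
  have hflat (i : ℕ) : Module.Flat R (P.complex.X i) := by
    have := (IsProjective.iff_projective (R := R) (P.complex.X i)).mpr (P.projective i)
    infer_instance
  have hex (i : ℕ) : Function.Exact (P.complex.d (i + 2) (i + 1)).hom
      (P.complex.d (i + 1) i).hom :=
    function_exact_of_shortComplex_exact (P.exact_succ i)
  have hs0 : s ≠ 0 := by rintro rfl; exact hs (zero_mem _)
  have hsm (a : R) (ha : a ∈ maximalIdeal R) : s * a = 0 :=
    Submodule.mem_annihilator.mp hsoc a ha
  induction j generalizing M with
  | zero =>
    obtain ⟨n, g, hg, hmin⟩ := exists_minimal_free_cover R M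
    suffices h : LinearMap.ker g = ⊥ from
      Module.Free.of_equiv (LinearEquiv.ofBijective g ⟨LinearMap.ker_eq_bot.mp h, hg⟩)
    refine eq_bot_of_forall_tmul_eq_zero hcq hs e he _ fun k => ?_
    obtain ⟨ε, hε, hε_surj⟩ : ∃ ε : P.complex.X 0 →ₗ[R] N,
        Function.Exact (P.complex.d 1 0).hom ε ∧ Function.Surjective ε :=
      ⟨(P.π.f 0).hom, function_exact_of_shortComplex_exact P.exact₀,
        (ModuleCat.epi_iff_surjective (P.π.f 0)).mp inferInstance⟩
    obtain ⟨x, hx⟩ := hε_surj (e.symm s)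
    have hker : (k : Fin n → R) ⊗ₜ[R] e.symm s = 0 := by
      rw [pi_eq_sum_univ' (k : Fin n → R), TensorProduct.sum_tmul]
      refine Finset.sum_eq_zero fun i _ => ?_
      have : (k : Fin n → R) i • e.symm s = 0 := e.injective <| by
        rw [he, AddEquiv.apply_symm_apply, map_zero, ← Nat.succ_pred_eq_of_ne_zero hq, pow_succ,
          mul_assoc, mul_comm _ s, hsm _ (hmin k k.2 i), mul_zero]
      rw [TensorProduct.smul_tmul, this, TensorProduct.tmul_zero]
    obtain ⟨y, hy⟩ := mem_range_lTensor_of_exact (LinearMap.ker g).injective_subtype hg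
      (LinearMap.exact_subtype_ker_map g) (hex 0) hε hM (k ⊗ₜ x)
      (by rw [TensorProduct.map_tmul, hx]; exact hker)
    rw [← hx, ← LinearMap.lTensor_tmul, ← hy, ← LinearMap.comp_apply, ← LinearMap.lTensor_comp,
      hε.linearMap_comp_eq_zero, LinearMap.lTensor_zero, LinearMap.zero_apply]
  | succ j ih =>
    obtain ⟨n, g, hg, hmin⟩ := exists_minimal_free_cover R M
    suffices h : LinearMap.ker g = ⊥ from
      Module.Free.of_equiv (LinearEquiv.ofBijective g ⟨LinearMap.ker_eq_bot.mp h, hg⟩)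
    have hfree : Module.Free R (LinearMap.ker g) := ih _ fun z => ⟨fun hz => by
        refine mem_range_lTensor_of_exact (LinearMap.ker g).injective_subtype hg
          (LinearMap.exact_subtype_ker_map g) (hex (j + 1)) (hex j) hM z ?_
        rw [← LinearMap.rTensor_comp_lTensor, LinearMap.comp_apply, hz, map_zero], by
        rintro ⟨y, rfl⟩
        rw [← LinearMap.comp_apply, ← LinearMap.lTensor_comp, (hex j).linearMap_comp_eq_zero,
          LinearMap.lTensor_zero, LinearMap.zero_apply]⟩
    have hkill (k : LinearMap.ker g) : s • k = 0 := by
      ext i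
      exact hsm _ (hmin k k.2 i)
    rw [← Submodule.subsingleton_iff_eq_bot]
    by_contra h
    rw [not_subsingleton_iff_nontrivial] at h
    let b := Module.Free.chooseBasis R (LinearMap.ker g)
    obtain ⟨i⟩ := b.index_nonempty
    have := congrArg (fun x => b.repr x i) (hkill (b i))
    simp at this
    exact hs0 this

/-- Vanishing of `Tor` in positive degree, read off on a projective resolution of the second
argument. -/
theorem exact_lTensor_of_subsingleton_tor {R : Type u} [CommRing R] {M N : ModuleCat.{u} R}
    (P : ProjectiveResolution N) (j : ℕ)
    (h : Subsingleton (((Tor (ModuleCat.{u} R) (j + 1)).obj M).obj N)) :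
    Function.Exact ((P.complex.d (j + 2) (j + 1)).hom.lTensor M)
      ((P.complex.d (j + 1) j).hom.lTensor M) := by
  have hzero := (@ModuleCat.isZero_of_subsingleton R _ _ h).of_iso
    (P.isoLeftDerivedObj ((MonoidalCategory.tensoringLeft (ModuleCat.{u} R)).obj M) (j + 1)).symm
  have hexact := (HomologicalComplex.exactAt_iff' _ (j + 2) (j + 1) j (by simp) (by simp)).mp
    ((HomologicalComplex.exactAt_iff_isZero_homology _ _).mpr hzero)
  exact function_exact_of_shortComplex_exact hexact

/-- Let `(R, m)` be a Noetherian local commutative ring of prime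
characteristic `p` with `depth R = 0`, and let `c = c(R)` be the smallest positive
integer `s` such that the socle `(0 : m)_R` is not contained in `m^s`.  If `M` is a
finitely generated `R`-module with `Tor^R_j(M, ^{φ^r}R) = 0` for some `j ≥ 1` and some
`r` with `p^r > c(R)`, then `M` is projective. -/
theorem stmt4 {R : Type u} [CommRing R] [IsNoetherianRing R] [IsLocalRing R]
    (p : ℕ) (hp : p.Prime) [CharP R p]
    (hdepth : depthWrt R (IsLocalRing.maximalIdeal R) = 0)
    (c : ℕ) (hc0 : 0 < c)
    (hc : ¬ ((IsLocalRing.maximalIdeal R).annihilator ≤ IsLocalRing.maximalIdeal R ^ c))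
    (hcmin : ∀ s : ℕ, 0 < s → s < c →
      (IsLocalRing.maximalIdeal R).annihilator ≤ IsLocalRing.maximalIdeal R ^ s)
    (M : Type u) [AddCommGroup M] [Module R M] [Module.Finite R M]
    (j r : ℕ) (hj : 1 ≤ j) (hr : c < p ^ r)
    (f : R →+* R) (hf : ∀ a, f a = a ^ p ^ r)
    (htor : Subsingleton
      (((Tor (ModuleCat.{u} R) j).obj (ModuleCat.of R M)).obj (frobMod f))) :
    Module.Projective R M := by
  obtain ⟨s, hsoc, hs⟩ := SetLike.not_le_iff_exists.mp hc
  obtain ⟨j, rfl⟩ := Nat.exists_eq_add_of_le' hj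
  have := free_of_exact_lTensor_projectiveResolution (pow_ne_zero r hp.ne_zero) hr.le hsoc hs
    (N := frobMod f) (AddEquiv.refl R) (fun a b => congrArg (· * _) (hf a))
    (ProjectiveResolution.of (frobMod f)) j M (exact_lTensor_of_subsingleton_tor _ j htor)
  infer_instance
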